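/- arXiv:1410.3502 — 2 statements merged into one kernel-verified Lean document; each statement's English description precedes it below -/
import Mathlib

section
/- Let f ∈ C²[0,1]. Then there exists a natural number n₀ (depending on f) such that for all n ≥ n₀, ‖B_n f − f − (1/(2n))·φ²·f″‖ ≤ 4·ω²_φ(f, 1/√n). -/
open Real Set Filter

/-- `φ(x) = √(x(1-x))`. -/
noncomputable def phi (x : ℝ) : ℝ := Real.sqrt (x * (1 - x))

/-- The Bernstein operator `B_n(f;x) = ∑_{k=0}^n f(k/n) C(n,k) x^k (1-x)^{n-k}`. -/
noncomputable def bern (n : ℕ) (f : ℝ → ℝ) (x : ℝ) : ℝ :=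
  ∑ k ∈ Finset.range (n + 1),
    f ((k : ℝ) / (n : ℝ)) * (n.choose k : ℝ) * x ^ k * (1 - x) ^ (n - k)

/-- The sup norm on `[0,1]`. -/
noncomputable def supNorm (g : ℝ → ℝ) : ℝ := sSup ((fun x => |g x|) '' Set.Icc 0 1)

/-- The second order Ditzian–Totik modulus of smoothness. -/
noncomputable def omega2phi (f : ℝ → ℝ) (δ : ℝ) : ℝ :=
  sSup {y : ℝ | ∃ h ∈ Set.Icc (0 : ℝ) δ,
    ∃ x ∈ Set.Icc (h ^ 2 / (1 + h ^ 2)) (1 / (1 + h ^ 2)),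
      y = |f (x + h * phi x) - 2 * f x + f (x - h * phi x)|}

/-- The usual first modulus of continuity on `[0,1]`. -/
noncomputable def omega1 (g : ℝ → ℝ) (δ : ℝ) : ℝ :=
  sSup {y : ℝ | ∃ x ∈ Set.Icc (0 : ℝ) 1, ∃ z ∈ Set.Icc (0 : ℝ) 1,
    |x - z| ≤ δ ∧ y = |g x - g z|}

/-- The usual second modulus of smoothness on `[0,1]`. -/
noncomputable def omega2 (g : ℝ → ℝ) (δ : ℝ) : ℝ :=
  sSup {y : ℝ | ∃ h : ℝ, 0 < h ∧ h ≤ δ ∧ ∃ x : ℝ, x ∈ Set.Icc (0 : ℝ) 1 ∧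
    x + 2 * h ∈ Set.Icc (0 : ℝ) 1 ∧ y = |g (x + 2 * h) - 2 * g (x + h) + g x|}

/-- Expectation of `F` under the binomial weights. -/
noncomputable def binE (x : ℝ) (n : ℕ) (F : ℕ → ℝ) : ℝ :=
  ∑ k ∈ Finset.range (n + 1), (n.choose k : ℝ) * (x ^ k * (1 - x) ^ (n - k) * F k)

lemma binE_succ (x : ℝ) (n : ℕ) (F : ℕ → ℝ) :
    binE x (n + 1) F = x * binE x n (fun k => F (k + 1)) + (1 - x) * binE x n F := by
  have h := Finset.sum_antidiagonal_choose_succ_mul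
    (fun i j => x ^ i * (1 - x) ^ j * F i) n
  have e : ∀ (m : ℕ) (G : ℕ → ℝ), binE x m G =
      ∑ ij ∈ Finset.HasAntidiagonal.antidiagonal m, (m.choose ij.1 : ℝ) * (x ^ ij.1 * (1 - x) ^ ij.2 * G ij.1) := by
    intro m G
    rw [Finset.Nat.sum_antidiagonal_eq_sum_range_succ
      (fun i j => (m.choose i : ℝ) * (x ^ i * (1 - x) ^ j * G i))]
    rfl
  rw [e, e, e, h, add_comm, Finset.mul_sum, Finset.mul_sum]
  congr 1
  · apply Finset.sum_congr rfl
    intro ij hij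
    have : n.choose ij.2 = n.choose ij.1 := by
      rw [← Finset.HasAntidiagonal.mem_antidiagonal.mp hij]
      exact Nat.choose_symm_add.symm
    rw [this]; ring
  · apply Finset.sum_congr rfl
    intro ij _
    ring

lemma binE_poly (x : ℝ) (n : ℕ) : ∀ a b c d e : ℝ,
    binE x n (fun k => a * ((k : ℝ) - n * x) ^ 4 + b * ((k : ℝ) - n * x) ^ 3
      + c * ((k : ℝ) - n * x) ^ 2 + d * ((k : ℝ) - n * x) + e) =
    a * (n * (x * (1 - x)) * (1 - 6 * (x * (1 - x))) + 3 * n ^ 2 * (x * (1 - x)) ^ 2)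
      + b * (n * (x * (1 - x)) * (1 - 2 * x)) + c * (n * (x * (1 - x))) + e := by
  induction n with
  | zero => intro a b c d e; simp [binE]
  | succ n ih =>
    intro a b c d e
    have key : ∀ s : ℝ, (fun k : ℕ => a * (((k : ℝ) - n * x) + s) ^ 4
        + b * (((k : ℝ) - n * x) + s) ^ 3
        + c * (((k : ℝ) - n * x) + s) ^ 2 + d * (((k : ℝ) - n * x) + s) + e) =
        (fun k : ℕ => a * ((k : ℝ) - n * x) ^ 4 + (4 * a * s + b) * ((k : ℝ) - n * x) ^ 3
        + (6 * a * s ^ 2 + 3 * b * s + c) * ((k : ℝ) - n * x) ^ 2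
        + (4 * a * s ^ 3 + 3 * b * s ^ 2 + 2 * c * s + d) * ((k : ℝ) - n * x)
        + (a * s ^ 4 + b * s ^ 3 + c * s ^ 2 + d * s + e)) := by
      intro s
      funext k
      ring
    rw [binE_succ]
    have e1 : (fun k : ℕ => a * (((k + 1 : ℕ) : ℝ) - ((n + 1 : ℕ) : ℝ) * x) ^ 4
        + b * (((k + 1 : ℕ) : ℝ) - ((n + 1 : ℕ) : ℝ) * x) ^ 3
        + c * (((k + 1 : ℕ) : ℝ) - ((n + 1 : ℕ) : ℝ) * x) ^ 2
        + d * (((k + 1 : ℕ) : ℝ) - ((n + 1 : ℕ) : ℝ) * x) + e) =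
        (fun k : ℕ => a * (((k : ℝ) - n * x) + (1 - x)) ^ 4
        + b * (((k : ℝ) - n * x) + (1 - x)) ^ 3
        + c * (((k : ℝ) - n * x) + (1 - x)) ^ 2 + d * (((k : ℝ) - n * x) + (1 - x)) + e) := by
      funext k; push_cast; ring
    have e2 : (fun k : ℕ => a * ((k : ℝ) - ((n + 1 : ℕ) : ℝ) * x) ^ 4
        + b * ((k : ℝ) - ((n + 1 : ℕ) : ℝ) * x) ^ 3
        + c * ((k : ℝ) - ((n + 1 : ℕ) : ℝ) * x) ^ 2
        + d * ((k : ℝ) - ((n + 1 : ℕ) : ℝ) * x) + e) =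
        (fun k : ℕ => a * (((k : ℝ) - n * x) + (-x)) ^ 4
        + b * (((k : ℝ) - n * x) + (-x)) ^ 3
        + c * (((k : ℝ) - n * x) + (-x)) ^ 2 + d * (((k : ℝ) - n * x) + (-x)) + e) := by
      funext k; push_cast; ring
    rw [e1, e2, key, key, ih, ih]
    push_cast
    ring

lemma binE_sub (x : ℝ) (n : ℕ) (F G : ℕ → ℝ) :
    binE x n (fun k => F k - G k) = binE x n F - binE x n G := by
  simp only [binE, mul_sub, Finset.sum_sub_distrib]

lemma binE_abs (x : ℝ) (hx : x ∈ Icc (0 : ℝ) 1) (n : ℕ) (F G : ℕ → ℝ)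
    (h : ∀ k ≤ n, |F k| ≤ G k) : |binE x n F| ≤ binE x n G := by
  unfold binE
  refine (Finset.abs_sum_le_sum_abs _ _).trans (Finset.sum_le_sum ?_)
  intro k hk
  have h1 : 0 ≤ x := hx.1
  have h2 : 0 ≤ 1 - x := by linarith [hx.2]
  rw [abs_mul, abs_mul, abs_of_nonneg (by positivity), abs_of_nonneg (by positivity)]
  have := h k (by simpa [Nat.lt_succ_iff] using hk)
  gcongr

lemma phi_sq (x : ℝ) (hx : x ∈ Icc (0 : ℝ) 1) : phi x ^ 2 = x * (1 - x) := by
  unfold phi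
  exact Real.sq_sqrt (mul_nonneg hx.1 (by linarith [hx.2]))

lemma bern_bound (f p g : ℝ → ℝ) (ε K : ℝ) (hε : 0 ≤ ε) (hK : 0 ≤ K)
    (H : ∀ x ∈ Icc (0 : ℝ) 1, ∀ t ∈ Icc (0 : ℝ) 1,
      |f t - f x - p x * (t - x) - g x / 2 * (t - x) ^ 2| ≤ (ε + K * (t - x) ^ 2) * (t - x) ^ 2)
    (n : ℕ) (hn : 1 ≤ n) (x : ℝ) (hx : x ∈ Icc (0 : ℝ) 1) :
    |bern n f x - f x - 1 / (2 * n) * phi x ^ 2 * g x| ≤ ε / (4 * n) + K / n ^ 2 := by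
  have hn0 : (1 : ℝ) ≤ n := by exact_mod_cast hn
  have hnn : (n : ℝ) ≠ 0 := by positivity
  have h1 : bern n f x = binE x n (fun k => f ((k : ℝ) / n)) := by
    unfold bern binE
    exact Finset.sum_congr rfl fun k _ => by ring
  have h2 := binE_poly x n 0 0 (g x / 2 / n ^ 2) (p x / n) (f x)
  have h3 : bern n f x - f x - 1 / (2 * n) * phi x ^ 2 * g x =
      binE x n (fun k => f ((k : ℝ) / n) - (0 * ((k : ℝ) - n * x) ^ 4 + 0 * ((k : ℝ) - n * x) ^ 3
      + (g x / 2 / n ^ 2) * ((k : ℝ) - n * x) ^ 2 + (p x / n) * ((k : ℝ) - n * x) + f x)) := by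
    rw [binE_sub, h2, h1, phi_sq x hx]
    field_simp
    ring
  rw [h3]
  have h4 := binE_poly x n (K / n ^ 4) 0 (ε / n ^ 2) 0 0
  refine (binE_abs x hx n _ _ ?_).trans (h4.le.trans ?_)
  · intro k hk
    have hkn : (k : ℝ) ≤ n := by exact_mod_cast hk
    have := H x hx (k / n) ⟨by positivity, by rw [div_le_one (by positivity)]; exact hkn⟩
    convert this using 1
    · congr 1
      field_simp
      ring
    · field_simp
      ring
  · have hX0 : 0 ≤ x * (1 - x) := mul_nonneg hx.1 (by linarith [hx.2])
    have hX1 : x * (1 - x) ≤ 1 / 4 := by nlinarith [sq_nonneg (x - 1 / 2)]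
    set X := x * (1 - x)
    have m4 : n * X * (1 - 6 * X) + 3 * n ^ 2 * X ^ 2 ≤ (n : ℝ) ^ 2 := by
      have a1 : n * X * (1 - 6 * X) ≤ n * (1 / 4) * 1 := by
        have : (n * X) * (1 - 6 * X) ≤ (n * X) * 1 := by
          apply mul_le_mul_of_nonneg_left _ (by positivity); linarith
        nlinarith
      have a2 : X ^ 2 ≤ 1 / 16 := by nlinarith
      have a3 : 3 * (n : ℝ) ^ 2 * X ^ 2 ≤ 3 * n ^ 2 * (1 / 16) := by gcongr
      nlinarith
    have b1 : K / n ^ 4 * (n * X * (1 - 6 * X) + 3 * n ^ 2 * X ^ 2) ≤ K / n ^ 4 * n ^ 2 := by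
      gcongr
    have b2 : ε / n ^ 2 * (n * X) ≤ ε / n ^ 2 * (n * (1 / 4)) := by gcongr
    have c1 : K / n ^ 4 * (n : ℝ) ^ 2 = K / n ^ 2 := by field_simp
    have c2 : ε / n ^ 2 * (n * (1 / 4)) = ε / (4 * n) := by field_simp
    rw [c1] at b1
    rw [c2] at b2
    linarith

lemma taylor_bound (f p g : ℝ → ℝ) (ε K : ℝ) (hε : 0 ≤ ε) (hK : 0 ≤ K)
    (hp : ∀ x ∈ Icc (0 : ℝ) 1, HasDerivWithinAt f (p x) (Icc 0 1) x)
    (hg : ∀ x ∈ Icc (0 : ℝ) 1, HasDerivWithinAt p (g x) (Icc 0 1) x)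
    (H : ∀ x ∈ Icc (0 : ℝ) 1, ∀ t ∈ Icc (0 : ℝ) 1, |g t - g x| ≤ ε + K * (t - x) ^ 2) :
    ∀ x ∈ Icc (0 : ℝ) 1, ∀ t ∈ Icc (0 : ℝ) 1,
      |f t - f x - p x * (t - x) - g x / 2 * (t - x) ^ 2| ≤
        (ε + K * (t - x) ^ 2) * (t - x) ^ 2 := by
  intro x hx t ht
  have hsub : uIcc x t ⊆ Icc 0 1 := by
    rw [← uIcc_of_le (zero_le_one' ℝ)] at *
    exact uIcc_subset_uIcc hx ht
  have hab : ∀ s ∈ uIcc x t, |s - x| ≤ |t - x| := fun s hs => abs_sub_left_of_mem_uIcc hs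
  set C := ε + K * (t - x) ^ 2 with hC
  have hC0 : 0 ≤ C := by positivity
  have d1 : ∀ s ∈ uIcc x t, |p s - p x - g x * (s - x)| ≤ C * |t - x| := by
    intro s hs
    have := (convex_uIcc x t).norm_image_sub_le_of_norm_hasDerivWithin_le
      (f := fun s => p s - g x * (s - x)) (f' := fun s => g s - g x * 1) (C := C)
      (fun u hu => ((hg u (hsub hu)).mono hsub).sub
        (((hasDerivWithinAt_id u _).sub_const x).const_mul (g x)))
      (fun u hu => by
        rw [mul_one, Real.norm_eq_abs]
        refine (H x hx u (hsub hu)).trans ?_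
        have := sq_le_sq.mpr (hab u hu)
        rw [hC]; gcongr) left_mem_uIcc hs
    simp only [Real.norm_eq_abs, sub_self, mul_zero, sub_zero] at this
    calc |p s - p x - g x * (s - x)| = |p s - g x * (s - x) - p x| := by congr 1; ring
      _ ≤ _ := this
      _ ≤ _ := mul_le_mul_of_nonneg_left (hab s hs) hC0
  have := (convex_uIcc x t).norm_image_sub_le_of_norm_hasDerivWithin_le
      (f := fun s => f s - p x * (s - x) - g x / 2 * (s - x) ^ 2)
      (f' := fun s => p s - p x * 1 - g x / 2 * (((2 : ℕ) : ℝ) * (s - x) ^ (2 - 1) * 1))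
      (C := C * |t - x|)
      (fun u hu => (((hp u (hsub hu)).mono hsub).sub
        (((hasDerivWithinAt_id u _).sub_const x).const_mul (p x))).sub
        ((((hasDerivWithinAt_id u _).sub_const x).pow 2).const_mul (g x / 2)))
      (fun u hu => by
        rw [Real.norm_eq_abs]
        convert d1 u hu using 2
        norm_num
        ring) left_mem_uIcc right_mem_uIcc
  simp only [Real.norm_eq_abs, sub_self, mul_zero, sub_zero] at this
  rw [mul_assoc, ← sq, sq_abs] at this
  norm_num at this
  convert this using 2
  ring

lemma modulus_bound (g : ℝ → ℝ) (hg : ContinuousOn g (Icc 0 1)) (ε : ℝ) (hε : 0 < ε) :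
    ∃ K : ℝ, 0 ≤ K ∧ ∀ x ∈ Icc (0 : ℝ) 1, ∀ t ∈ Icc (0 : ℝ) 1,
      |g t - g x| ≤ ε + K * (t - x) ^ 2 := by
  obtain ⟨M, hM⟩ := isCompact_Icc.exists_bound_of_continuousOn hg
  have hM0 : 0 ≤ M := (norm_nonneg _).trans (hM 0 (by simp))
  have hu := isCompact_Icc.uniformContinuousOn_of_continuous hg
  rw [Metric.uniformContinuousOn_iff] at hu
  obtain ⟨δ, hδ, h⟩ := hu ε hε
  refine ⟨2 * M / δ ^ 2, by positivity, fun x hx t ht => ?_⟩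
  by_cases hd : |t - x| < δ
  · have := h t ht x hx (by rwa [Real.dist_eq])
    rw [Real.dist_eq] at this
    have : 0 ≤ 2 * M / δ ^ 2 * (t - x) ^ 2 := by positivity
    linarith
  · push Not at hd
    have h1 : δ ^ 2 ≤ (t - x) ^ 2 := by
      rw [← sq_abs (t - x)]; gcongr
    have h2 : 2 * M ≤ 2 * M / δ ^ 2 * (t - x) ^ 2 := by
      rw [div_mul_eq_mul_div, le_div_iff₀ (by positivity)]
      gcongr
    have h3 := hM x hx
    have h4 := hM t ht
    rw [Real.norm_eq_abs] at h3 h4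
    have := abs_sub (g t) (g x)
    linarith

lemma step_mem (h x : ℝ) (h0 : 0 ≤ h)
    (hx : x ∈ Icc (h ^ 2 / (1 + h ^ 2)) (1 / (1 + h ^ 2))) :
    x ∈ Icc (0 : ℝ) 1 ∧ x + h * phi x ∈ Icc (0 : ℝ) 1 ∧ x - h * phi x ∈ Icc (0 : ℝ) 1 := by
  obtain ⟨h1, h2⟩ := hx
  have hp : 0 < 1 + h ^ 2 := by positivity
  have hx0 : 0 ≤ x := le_trans (by positivity) h1
  have hx1 : x ≤ 1 := h2.trans (by rw [div_le_one hp]; nlinarith [sq_nonneg h])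
  rw [div_le_iff₀ hp] at h1
  rw [le_div_iff₀ hp] at h2
  have hph : 0 ≤ phi x := Real.sqrt_nonneg _
  have hsq := phi_sq x ⟨hx0, hx1⟩
  have a : h * phi x ≤ x := by
    refine (abs_le.mp (abs_le_of_sq_le_sq ?_ hx0)).2
    rw [mul_pow, hsq]; nlinarith
  have b : h * phi x ≤ 1 - x := by
    refine (abs_le.mp (abs_le_of_sq_le_sq ?_ (by linarith))).2
    rw [mul_pow, hsq]; nlinarith
  have c : 0 ≤ h * phi x := by positivity
  exact ⟨⟨hx0, hx1⟩, ⟨by linarith, by linarith⟩, ⟨by linarith, by linarith⟩⟩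

lemma omega_ge (f : ℝ → ℝ) (hf : ContinuousOn f (Icc 0 1)) (δ x : ℝ) (h0 : 0 ≤ δ)
    (hx : x ∈ Icc (δ ^ 2 / (1 + δ ^ 2)) (1 / (1 + δ ^ 2))) :
    |f (x + δ * phi x) - 2 * f x + f (x - δ * phi x)| ≤ omega2phi f δ := by
  obtain ⟨M, hM⟩ := isCompact_Icc.exists_bound_of_continuousOn hf
  apply le_csSup
  · refine ⟨4 * M, ?_⟩
    rintro y ⟨h, hh, z, hz, rfl⟩
    obtain ⟨a, b, c⟩ := step_mem h z hh.1 hz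
    have a := abs_le.mp (hM _ a)
    have b := abs_le.mp (hM _ b)
    have c := abs_le.mp (hM _ c)
    rw [abs_le]
    constructor <;> linarith
  · exact ⟨δ, ⟨h0, le_rfl⟩, x, hx, rfl⟩

lemma main_aux (f p g : ℝ → ℝ)
    (hp : ∀ x ∈ Icc (0 : ℝ) 1, HasDerivWithinAt f (p x) (Icc 0 1) x)
    (hg : ∀ x ∈ Icc (0 : ℝ) 1, HasDerivWithinAt p (g x) (Icc 0 1) x)
    (hc : ContinuousOn g (Icc 0 1)) :
    ∃ n₀ : ℕ, ∀ n : ℕ, n₀ ≤ n → ∀ x ∈ Icc (0 : ℝ) 1,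
      |bern n f x - f x - 1 / (2 * n) * phi x ^ 2 * g x| ≤ 4 * omega2phi f (1 / Real.sqrt n) := by
  have hfc : ContinuousOn f (Icc 0 1) := fun x hx => (hp x hx).continuousWithinAt
  by_cases hz : ∃ x ∈ Ioo (0 : ℝ) 1, g x ≠ 0
  · obtain ⟨x, hx, hgx⟩ := hz
    have hxI : x ∈ Icc (0 : ℝ) 1 := Ioo_subset_Icc_self hx
    have hX : 0 < x * (1 - x) := mul_pos hx.1 (by linarith [hx.2])
    have hX1 : x * (1 - x) ≤ 1 / 4 := by nlinarith [sq_nonneg (x - 1 / 2)]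
    have hsq := phi_sq x hxI
    set X := x * (1 - x) with hXdef
    have hG : 0 < |g x| := abs_pos.mpr hgx
    set G := |g x| with hGdef
    obtain ⟨K, hK, hmod⟩ := modulus_bound g hc (X * G / 4) (by positivity)
    have hT := taylor_bound f p g (X * G / 4) K (by positivity) hK hp hg hmod
    have hlim := tendsto_one_div_atTop_nhds_zero_nat (𝕜 := ℝ)
    have ev1 : ∀ᶠ n : ℕ in atTop, (1 : ℝ) / n < x := hlim.eventually_lt_const hx.1
    have ev2 : ∀ᶠ n : ℕ in atTop, (1 : ℝ) / n < 1 - x :=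
      hlim.eventually_lt_const (by linarith [hx.2])
    have hlimK : Tendsto (fun n : ℕ => K * ((1 : ℝ) / n)) atTop (nhds 0) := by
      simpa using hlim.const_mul K
    have ev3 : ∀ᶠ n : ℕ in atTop, K * ((1 : ℝ) / n) < X * G / 4 :=
      hlimK.eventually_lt_const (by positivity)
    obtain ⟨n₀, hn₀⟩ := eventually_atTop.mp
      ((ev1.and (ev2.and ev3)).and (eventually_ge_atTop 1))
    refine ⟨n₀, fun n hn y hy => ?_⟩
    obtain ⟨⟨e1, e2, e3⟩, hn1⟩ := hn₀ n hn
    have hnR : (1 : ℝ) ≤ n := by exact_mod_cast hn1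
    have hB := bern_bound f p g (X * G / 4) K (by positivity) hK hT n hn1 y hy
    set δ := 1 / Real.sqrt n with hδ
    have hδ0 : 0 ≤ δ := by positivity
    have hδ2 : δ ^ 2 = 1 / n := by
      rw [hδ, div_pow, Real.sq_sqrt (by positivity), one_pow]
    have hxr : x ∈ Icc (δ ^ 2 / (1 + δ ^ 2)) (1 / (1 + δ ^ 2)) := by
      have : 0 < δ ^ 2 := by rw [hδ2]; positivity
      rw [← hδ2] at e1 e2
      constructor
      · rw [div_le_iff₀ (by positivity)]; nlinarith
      · rw [le_div_iff₀ (by positivity)]; nlinarith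
    have hw := omega_ge f hfc δ x hδ0 hxr
    obtain ⟨-, m1, m2⟩ := step_mem δ x hδ0 hxr
    have t1 := hT x hxI _ m1
    have t2 := hT x hxI _ m2
    have hd2 : (δ * phi x) ^ 2 = X / n := by rw [mul_pow, hδ2, hsq]; ring
    set d := δ * phi x
    rw [show x + d - x = d by ring, hd2] at t1
    rw [show x - d - x = -d by ring, neg_sq, hd2] at t2
    have hlow : G * (X / n) - 2 * ((X * G / 4 + K * (X / n)) * (X / n)) ≤
        |f (x + d) - 2 * f x + f (x - d)| := by
      have e : g x * (X / n) = (f (x + d) - 2 * f x + f (x - d))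
        - (f (x + d) - f x - p x * d - g x / 2 * (X / n))
        - (f (x - d) - f x - p x * -d - g x / 2 * (X / n)) := by ring
      have e' : G * (X / n) = |g x * (X / n)| := by
        rw [abs_mul, abs_of_nonneg (by positivity : 0 ≤ X / n)]
      rw [e', e]
      have q1 := abs_sub ((f (x + d) - 2 * f x + f (x - d))
        - (f (x + d) - f x - p x * d - g x / 2 * (X / n)))
        (f (x - d) - f x - p x * -d - g x / 2 * (X / n))
      have q2 := abs_sub (f (x + d) - 2 * f x + f (x - d))
        (f (x + d) - f x - p x * d - g x / 2 * (X / n))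
      linarith
    refine hB.trans (le_trans ?_ (mul_le_mul_of_nonneg_left (hlow.trans hw) (by norm_num)))
    have s : (0 : ℝ) < 1 / n := by positivity
    have r1 : X * G / 4 / (4 * n) + K / n ^ 2 = (X * G / 16 + K * (1 / n)) * (1 / n) := by
      field_simp; ring
    have r2 : 4 * (G * (X / n) - 2 * ((X * G / 4 + K * (X / n)) * (X / n))) =
        (4 * X * (G - 2 * (X * G / 4 + X * (K * (1 / n))))) * (1 / n) := by
      field_simp
    rw [r1, r2]
    apply mul_le_mul_of_nonneg_right _ s.le
    have u1 : X * G ≤ G / 4 := by nlinarith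
    have u2 : X * (K * (1 / n)) ≤ X * (X * G / 4) := by gcongr
    have u3 : X * (X * G / 4) ≤ G / 64 := by nlinarith
    have u4 : G / 2 ≤ G - 2 * (X * G / 4 + X * (K * (1 / n))) := by linarith
    have u5 : 4 * X * (G / 2) ≤ 4 * X * (G - 2 * (X * G / 4 + X * (K * (1 / n)))) := by gcongr
    have u6 : 0 < X * G := by positivity
    linarith
  · push Not at hz
    have hz' : EqOn g (fun _ => 0) (Icc 0 1) := by
      apply EqOn.of_subset_closure (s := Ioo 0 1) (fun x hx => hz x hx) hc continuousOn_const
        Ioo_subset_Icc_self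
      rw [closure_Ioo (zero_ne_one' ℝ)]
    have hT := taylor_bound f p g 0 0 le_rfl le_rfl hp hg (fun x hx t ht => by
      rw [hz' hx, hz' ht]; simp)
    refine ⟨1, fun n hn y hy => ?_⟩
    have hB := bern_bound f p g 0 0 le_rfl le_rfl hT n hn y hy
    refine hB.trans ?_
    have : 0 ≤ omega2phi f (1 / Real.sqrt n) := by
      apply Real.sSup_nonneg
      rintro y ⟨h, hh, z, hz, rfl⟩
      exact abs_nonneg _
    simpa using this

/-- **Theorem 3.** For any `f ∈ C²[0,1]` there exists `n₀` such that for all `n ≥ n₀`,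
`‖B_n f - f - (1/(2n))φ²f''‖ ≤ 4·ω²_φ(f,1/√n)`. -/
theorem voronovskaja_norm_estimate_C2
    (f : ℝ → ℝ) (hf : ContDiffOn ℝ 2 f (Set.Icc 0 1)) :
    ∃ n₀ : ℕ, ∀ n : ℕ, n₀ ≤ n →
      supNorm (fun x => bern n f x - f x -
          1 / (2 * n) * phi x ^ 2 * iteratedDerivWithin 2 f (Set.Icc 0 1) x) ≤
        4 * omega2phi f (1 / Real.sqrt n) := by
  have hu : UniqueDiffOn ℝ (Icc (0 : ℝ) 1) := uniqueDiffOn_Icc zero_lt_one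
  obtain ⟨n₀, h⟩ := main_aux f (iteratedDerivWithin 1 f (Icc 0 1))
    (iteratedDerivWithin 2 f (Icc 0 1))
    (fun x hx => by
      rw [iteratedDerivWithin_one]
      exact (hf.differentiableOn (by norm_num) x hx).hasDerivWithinAt)
    (fun x hx => by
      have e : iteratedDerivWithin 2 f (Icc 0 1) x =
          derivWithin (iteratedDerivWithin 1 f (Icc 0 1)) (Icc 0 1) x :=
        congrFun (iteratedDerivWithin_succ (n := 1) (f := f) (s := Icc 0 1)) x
      rw [e]
      exact ((hf.differentiableOn_iteratedDerivWithin (m := 1) (by norm_num) hu) x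
        hx).hasDerivWithinAt)
    (hf.continuousOn_iteratedDerivWithin (by norm_num) hu)
  refine ⟨n₀, fun n hn => ?_⟩
  apply csSup_le ((nonempty_Icc.mpr zero_le_one).image _)
  rintro _ ⟨x, hx, rfl⟩
  exact h n hn x hx
end

section
/- For f(x) = sin(x) on [0,1], with λ₀ = 32/(27π³) and n₂ = ⌊(424/(λ₀·sin(1/2)))²⌋ + 1, it holds for all natural numbers n ≥ n₂ that ‖B_n(sin) − sin‖ ≥ (1/64)·ω²_φ(sin, 1/√n). -/
open Real Set Filter

lemma phi_le_half (x : ℝ) : phi x ≤ 1 / 2 := by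
  unfold phi
  rw [Real.sqrt_le_left (by norm_num)]
  nlinarith [sq_nonneg (x - 1 / 2)]

lemma omega_le (n : ℕ) (hn : 1 ≤ n) :
    omega2phi Real.sin (1 / Real.sqrt n) ≤ 1 / (4 * n) := by
  have hn0 : (0 : ℝ) < n := by exact_mod_cast hn
  apply Real.sSup_le _ (by positivity)
  rintro y ⟨h, ⟨h0, h1⟩, x, -, rfl⟩
  have hp := phi_le_half x
  have hp0 : 0 ≤ phi x := Real.sqrt_nonneg _
  set d := h * phi x with hd
  have hd2 : d ^ 2 ≤ 1 / (4 * n) := by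
    have e1 : h ^ 2 ≤ 1 / n := by
      calc h ^ 2 ≤ (1 / Real.sqrt n) ^ 2 := by gcongr
        _ = 1 / (n : ℝ) := by rw [div_pow, Real.sq_sqrt hn0.le, one_pow]
    calc d ^ 2 = h ^ 2 * phi x ^ 2 := by rw [hd]; ring
      _ ≤ 1 / (n : ℝ) * (1 / 2) ^ 2 := by gcongr
      _ = 1 / (4 * (n : ℝ)) := by field_simp; norm_num
  have e : Real.sin (x + d) - 2 * Real.sin x + Real.sin (x - d)
      = Real.sin x * (-(2 * (1 - Real.cos d))) := by
    rw [Real.sin_add, Real.sin_sub]; ring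
  have hc : 0 ≤ 1 - Real.cos d := by linarith [Real.cos_le_one d]
  rw [e, abs_mul, abs_neg, abs_of_nonneg (by linarith : (0 : ℝ) ≤ 2 * (1 - Real.cos d))]
  have := Real.one_sub_sq_div_two_le_cos (x := d)
  calc |Real.sin x| * (2 * (1 - Real.cos d)) ≤ 1 * (2 * (1 - Real.cos d)) := by
        gcongr; exact Real.abs_sin_le_one x
    _ ≤ 1 / (4 * n) := by linarith

lemma bern_half (n : ℕ) (hn : 1 ≤ n) :
    bern n Real.sin (1 / 2) = Real.cos (1 / (2 * n)) ^ n * Real.sin (1 / 2) := by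
  have hn0 : (n : ℂ) ≠ 0 := by exact_mod_cast (by omega : n ≠ 0)
  set t : ℝ := 1 / (2 * n) with ht
  have htc : (t : ℂ) = 1 / (2 * n) := by rw [ht]; push_cast; rfl
  have key : ((Complex.exp (2 * t * Complex.I) * (1 / 2) + 1 / 2) : ℂ)
      = Complex.exp (t * Complex.I) * (Real.cos t : ℂ) := by
    rw [Complex.ofReal_cos, Complex.cos]
    have h1 : Complex.exp (2 * t * Complex.I)
        = Complex.exp (t * Complex.I) * Complex.exp (t * Complex.I) := by
      rw [← Complex.exp_add]; ring_nf
    have h2 : Complex.exp (t * Complex.I) * Complex.exp (-t * Complex.I) = 1 := by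
      rw [← Complex.exp_add]; simp
    rw [h1]
    linear_combination (-1 / 2 : ℂ) * h2
  have key2 := congrArg (fun z : ℂ => (z ^ n).im) key
  rw [mul_pow, ← Complex.exp_nat_mul, ← Complex.ofReal_pow, Complex.im_mul_ofReal] at key2
  have h3 : (n : ℂ) * (t * Complex.I) = ((1 / 2 : ℝ) : ℂ) * Complex.I := by
    rw [htc]; push_cast; field_simp
  rw [h3, Complex.exp_ofReal_mul_I_im] at key2
  rw [mul_comm, ← key2, add_pow, Complex.im_sum]
  unfold bern
  apply Finset.sum_congr rfl
  intro k hk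
  have h4 : (Complex.exp (2 * t * Complex.I) * (1 / 2)) ^ k * (1 / 2) ^ (n - k) * (n.choose k : ℂ)
      = Complex.exp (((k / n : ℝ) : ℂ) * Complex.I)
        * (((n.choose k : ℝ) * (1 / 2) ^ k * (1 / 2) ^ (n - k) : ℝ) : ℂ) := by
    rw [mul_pow, ← Complex.exp_nat_mul]
    have : (k : ℂ) * (2 * t * Complex.I) = ((k / n : ℝ) : ℂ) * Complex.I := by
      rw [htc]; push_cast; field_simp
    rw [this]; push_cast; ring
  rw [h4, Complex.im_mul_ofReal, Complex.exp_ofReal_mul_I_im]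
  norm_num
  ring

lemma cos_pow_le (n : ℕ) (hn : 1 ≤ n) :
    1 / (33 * n) ≤ 1 - Real.cos (1 / (2 * n)) ^ n := by
  have hn1 : (1 : ℝ) ≤ n := by exact_mod_cast hn
  have hn0 : (0 : ℝ) < n := by linarith
  set t : ℝ := 1 / (2 * n) with ht
  have ht0 : 0 < t := by positivity
  have ht1 : t ≤ 1 := by rw [ht, div_le_one (by positivity)]; linarith
  have hpi := Real.pi_gt_three
  have hpi4 := Real.pi_le_four
  have hc0 : 0 < Real.cos t := Real.cos_pos_of_mem_Ioo ⟨by linarith, by linarith⟩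
  have hq : Real.cos t ≤ 1 - 2 / π ^ 2 * t ^ 2 :=
    Real.cos_le_one_sub_mul_cos_sq (by rw [abs_of_pos ht0]; linarith)
  have h8 : 1 / 8 ≤ 2 / π ^ 2 := by
    rw [div_le_div_iff₀ (by norm_num) (by positivity)]; nlinarith
  set u : ℝ := 1 / (32 * n ^ 2) with hu
  have hu0 : 0 < u := by positivity
  have hut : u = 1 / 8 * t ^ 2 := by rw [hu, ht]; field_simp; norm_num
  have hcu : Real.cos t ≤ 1 - u := by nlinarith [sq_nonneg t]
  have hb : 1 + n * u ≤ (1 + u) ^ n := one_add_mul_le_pow (by linarith) n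
  have hprod : Real.cos t ^ n * (1 + u) ^ n ≤ 1 := by
    rw [← mul_pow]
    apply pow_le_one₀ (by positivity)
    nlinarith
  have hnu : n * u = 1 / (32 * n) := by rw [hu]; field_simp
  have hp : 0 < Real.cos t ^ n := by positivity
  have hx : Real.cos t ^ n * (1 + 1 / (32 * n)) ≤ 1 := by
    rw [← hnu]; exact le_trans (by gcongr) hprod
  have : Real.cos t ^ n * (32 * n + 1) ≤ 32 * n := by
    have := mul_le_mul_of_nonneg_right hx (by positivity : (0 : ℝ) ≤ 32 * n)
    calc _ = Real.cos t ^ n * (1 + 1 / (32 * n)) * (32 * n) := by field_simp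
      _ ≤ _ := by linarith
  rw [div_le_iff₀ (by positivity)]
  have hp1 : Real.cos t ^ n ≤ 1 := by nlinarith
  nlinarith

/-- **Example 3.** For `f = sin`, with `λ₀ = 32/(27π³)` and
`n₂ = ⌊(424/(λ₀ sin(1/2)))²⌋ + 1`, for all `n ≥ n₂`,
`‖B_n(sin) - sin‖ ≥ (1/64)·ω²_φ(sin,1/√n)`. -/
theorem example_sin :
    ∀ n : ℕ,
      Nat.floor ((424 / (32 / (27 * Real.pi ^ 3) * Real.sin (1 / 2))) ^ 2) + 1 ≤ n →
      1 / 64 * omega2phi Real.sin (1 / Real.sqrt n) ≤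
        supNorm (fun x => bern n Real.sin x - Real.sin x) := by
  intro n hn'
  have hn : 1 ≤ n := le_trans (Nat.le_add_left _ _) hn'
  have hn0 : (0 : ℝ) < n := by exact_mod_cast hn
  have hbdd : BddAbove ((fun x => |bern n Real.sin x - Real.sin x|) '' Set.Icc 0 1) := by
    apply isCompact_Icc.bddAbove_image
    unfold bern
    fun_prop
  have hle : |bern n Real.sin (1 / 2) - Real.sin (1 / 2)|
      ≤ supNorm (fun x => bern n Real.sin x - Real.sin x) :=
    le_csSup hbdd ⟨1 / 2, by constructor <;> norm_num, rfl⟩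
  have hs : 1 / 4 ≤ Real.sin (1 / 2) := by
    have := Real.sin_gt_sub_cube (x := 1 / 2) (by norm_num)
    linarith
  have hc := cos_pow_le n hn
  have hw := omega_le n hn
  refine le_trans ?_ hle
  rw [bern_half n hn, abs_sub_comm]
  refine le_trans ?_ (le_abs_self _)
  have h1 : 1 / (33 * n) * (1 / 4) ≤ (1 - Real.cos (1 / (2 * n)) ^ n) * Real.sin (1 / 2) := by
    have : (0 : ℝ) < 1 / (33 * n) := by positivity
    exact mul_le_mul hc hs (by norm_num) (by linarith)
  have h2 : 1 / 64 * (1 / (4 * (n : ℝ))) ≤ 1 / (33 * n) * (1 / 4) := by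
    have : (0 : ℝ) < 1 / n := by positivity
    have e1 : 1 / 64 * (1 / (4 * (n : ℝ))) = 1 / 256 * (1 / n) := by field_simp; norm_num
    have e2 : 1 / (33 * (n : ℝ)) * (1 / 4) = 1 / 132 * (1 / n) := by field_simp; norm_num
    rw [e1, e2]; linarith
  nlinarith
end
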